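/- (Quantitative form of Lemma C.1: low user satisfaction caps the achievable payoff.) In the deterministic linear model, let g be a simple policy with trajectory (x_t)_{t≥1} from initial state x₁ = 0, let x* ∈ ℝ, δ ∈ (0,1], and let T ≥ 1 be an integer. Suppose that for every t ≥ T, the number of indices τ with 2 ≤ τ ≤ t and x_τ ≤ x* is at least δ·(t − 1). Then J_0(g) ≤ (T − 1)·(C_R + K) + (C_R + K)/(1 − γ·f̃(x*)^δ). -/

import Mathlib

noncomputable section

open Filter Topology

/-- The modified demand function `f̃` built from the demand function `f`,
discount `γ` and friction `c`. -/
def ftilde (γ c : ℝ) (f : ℝ → ℝ) (x : ℝ) : ℝ :=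
  f x + ((1 - f x) * (1 - c) * f x * γ) / (1 - γ * (1 - (1 - c) * f x))

/-- States generated by an action sequence `a` from initial state `x0`:
`stTraj CE a x0 (t-1)` is the paper's `x_t`, so `stTraj CE a x0 0 = x0` is `x₁`. -/
def stTraj (CE : ℝ) (a : ℕ → ℝ) (x0 : ℝ) : ℕ → ℝ
  | 0 => x0
  | n + 1 => stTraj CE a x0 n + CE - a n

/-- (Discounted) payoff `J_{x0}(a)` of the action sequence `a` from initial state `x0`:
`Σ_{t=1}^∞ (C_R + a_t)·Π_{τ=2}^{t} (γ·f̃(x_τ))`. -/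
def payoff (γ c CR CE : ℝ) (f : ℝ → ℝ) (x0 : ℝ) (a : ℕ → ℝ) : ℝ :=
  ∑' t : ℕ, (CR + a t) *
    ∏ τ ∈ Finset.range t, (γ * ftilde γ c f (stTraj CE a x0 (τ + 1)))

/-- Trajectory induced by a simple policy `g` from initial state `x0`:
`polTraj CE g x0 (t-1)` is the paper's `x_t`. -/
def polTraj (CE : ℝ) (g : ℝ → ℝ) (x0 : ℝ) : ℕ → ℝ
  | 0 => x0
  | n + 1 => polTraj CE g x0 n + CE - g (polTraj CE g x0 n)

/-- Payoff `J_{x0}(g)` of the simple policy `g` from initial state `x0`. -/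
def polPayoff (γ c CR CE : ℝ) (f : ℝ → ℝ) (g : ℝ → ℝ) (x0 : ℝ) : ℝ :=
  payoff γ c CR CE f x0 (fun n => g (polTraj CE g x0 n))

/-- An action sequence takes values in `[-K, K]`. -/
def IsActionSeq (K : ℝ) (a : ℕ → ℝ) : Prop := ∀ n, a n ∈ Set.Icc (-K) K

/-- A simple policy takes values in `[-K, K]`. -/
def IsSimplePolicy (K : ℝ) (g : ℝ → ℝ) : Prop := ∀ x, g x ∈ Set.Icc (-K) K

/-- A simple policy `g` is optimal if from every initial state it weakly dominates
every action sequence. -/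
def IsOptimal (γ c CR CE K : ℝ) (f : ℝ → ℝ) (g : ℝ → ℝ) : Prop :=
  IsSimplePolicy K g ∧
  ∀ x0 : ℝ, ∀ a : ℕ → ℝ, IsActionSeq K a →
    payoff γ c CR CE f x0 a ≤ polPayoff γ c CR CE f g x0

/-- `f` has complexity `k`: it is piecewise constant with breakpoints `b₁ < … < b_k`,
constant on `(−∞,b₁)` and on each `[bᵢ, b_{i+1})` and `[b_k, ∞)`. -/
def HasComplexity (f : ℝ → ℝ) (k : ℕ) : Prop :=
  ∃ b : Fin k → ℝ, StrictMono b ∧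
    (∀ x y : ℝ, (∀ j : Fin k, x < b j) → (∀ j : Fin k, y < b j) → f x = f y) ∧
    (∀ i : Fin k, ∀ x y : ℝ, b i ≤ x → b i ≤ y →
      (∀ j : Fin k, i < j → x < b j) → (∀ j : Fin k, i < j → y < b j) → f x = f y)

/-- The value function `V(x)`: supremum of payoffs of action sequences from `x`. -/
def V (γ c CR CE K : ℝ) (f : ℝ → ℝ) (x : ℝ) : ℝ :=
  sSup {v : ℝ | ∃ a : ℕ → ℝ, IsActionSeq K a ∧ payoff γ c CR CE f x a = v}

/-- The Q-function `Q(i,x) = C_R + i + γ·f̃(x + C_E − i)·V(x + C_E − i)`. -/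
def Q (γ c CR CE K : ℝ) (f : ℝ → ℝ) (i x : ℝ) : ℝ :=
  CR + i + γ * ftilde γ c f (x + CE - i) * V γ c CR CE K f (x + CE - i)

lemma ftilde_eq (γ c : ℝ) (f : ℝ → ℝ) (x : ℝ)
    (hγ : γ ∈ Set.Ioo (0:ℝ) 1) (hc : c ∈ Set.Icc (0:ℝ) 1) (h : f x ∈ Set.Icc (0:ℝ) 1) :
    0 < 1 - γ + γ * (1 - c) * f x ∧
    ftilde γ c f x = f x * (1 - γ + γ * (1 - c)) / (1 - γ + γ * (1 - c) * f x) := by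
  have hp : 0 ≤ γ * (1 - c) * f x :=
    mul_nonneg (mul_nonneg hγ.1.le (by linarith [hc.2])) h.1
  have hpos : 0 < 1 - γ + γ * (1 - c) * f x := by linarith [hγ.2]
  refine ⟨hpos, ?_⟩
  have e : 1 - γ * (1 - (1 - c) * f x) = 1 - γ + γ * (1 - c) * f x := by ring
  unfold ftilde
  rw [e, eq_div_iff hpos.ne', add_mul, div_mul_cancel₀ _ hpos.ne']
  ring

lemma ftilde_mem (γ c : ℝ) (f : ℝ → ℝ) (x : ℝ)
    (hγ : γ ∈ Set.Ioo (0:ℝ) 1) (hc : c ∈ Set.Icc (0:ℝ) 1) (h : f x ∈ Set.Icc (0:ℝ) 1) :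
    0 ≤ ftilde γ c f x ∧ ftilde γ c f x ≤ 1 := by
  obtain ⟨hpos, e⟩ := ftilde_eq γ c f x hγ hc h
  have h1 : 0 ≤ γ * (1 - c) := mul_nonneg hγ.1.le (by linarith [hc.2])
  rw [e]
  constructor
  · exact div_nonneg (mul_nonneg h.1 (by linarith [hγ.2])) hpos.le
  · rw [div_le_one hpos]
    nlinarith [mul_nonneg (sub_nonneg.2 h.2) (sub_nonneg.2 hγ.2.le)]

lemma ftilde_mono (γ c : ℝ) (f : ℝ → ℝ) (x y : ℝ)
    (hγ : γ ∈ Set.Ioo (0:ℝ) 1) (hc : c ∈ Set.Icc (0:ℝ) 1) (hx : f x ∈ Set.Icc (0:ℝ) 1)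
    (hy : f y ∈ Set.Icc (0:ℝ) 1) (hxy : f x ≤ f y) :
    ftilde γ c f x ≤ ftilde γ c f y := by
  obtain ⟨hpx, ex⟩ := ftilde_eq γ c f x hγ hc hx
  obtain ⟨hpy, ey⟩ := ftilde_eq γ c f y hγ hc hy
  have h1 : 0 ≤ γ * (1 - c) := mul_nonneg hγ.1.le (by linarith [hc.2])
  rw [ex, ey, div_le_div_iff₀ hpx hpy]
  have h2 : 0 ≤ 1 - γ + γ * (1 - c) := by linarith [hγ.2]
  have h3 := mul_nonneg (mul_nonneg h2 (sub_nonneg.2 hγ.2.le)) (sub_nonneg.2 hxy)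
  nlinarith [h3]

lemma stTraj_eq_polTraj (CE : ℝ) (g : ℝ → ℝ) (x0 : ℝ) (n : ℕ) :
    stTraj CE (fun n => g (polTraj CE g x0 n)) x0 n = polTraj CE g x0 n := by
  induction n with
  | zero => rfl
  | succ n ih => simp only [stTraj, polTraj, ih]

lemma card_shift (p : ℕ → Prop) [DecidablePred p] (n : ℕ) :
    ((Finset.Icc 2 (n + 1)).filter (fun τ => p (τ - 1))).card
      = ((Finset.range n).filter (fun τ => p (τ + 1))).card := by
  symm
  refine Finset.card_bij (fun τ _ => τ + 2) ?_ ?_ ?_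
  · intro a ha
    simp only [Finset.mem_filter, Finset.mem_range, Finset.mem_Icc] at ha ⊢
    exact ⟨by omega, ha.2⟩
  · intro a _ b _ h
    simpa using h
  · intro b hb
    simp only [Finset.mem_filter, Finset.mem_range, Finset.mem_Icc] at hb
    refine ⟨b - 2, ?_, by omega⟩
    simp only [Finset.mem_filter, Finset.mem_range]
    refine ⟨by omega, ?_⟩
    have : b - 2 + 1 = b - 1 := by omega
    rw [this]
    exact hb.2

/-- Quantitative form of Lemma C.1: if along the trajectory of a simple policy `g` from
initial state `0` (with `polTraj CE g 0 (t-1)` the paper's `x_t`), for every `t ≥ T` at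
least a `δ`-fraction of the indices `2 ≤ τ ≤ t` have `x_τ ≤ x*`, then the payoff is at
most `(T−1)·(C_R+K) + (C_R+K)/(1 − γ·f̃(x*)^δ)`. -/
theorem stmt19 (γ c CR CE K : ℝ) (f : ℝ → ℝ)
    (hγ : γ ∈ Set.Ioo (0:ℝ) 1) (hc : c ∈ Set.Icc (0:ℝ) 1) (hK : 0 < K)
    (hCE0 : 0 ≤ CE) (hCEK : CE < K) (hCR : 0 ≤ CR)
    (hfmono : Monotone f) (hf01 : ∀ x, f x ∈ Set.Icc (0:ℝ) 1)
    (g : ℝ → ℝ) (hg : IsSimplePolicy K g)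
    (xstar : ℝ) (δ : ℝ) (hδ : δ ∈ Set.Ioc (0:ℝ) 1)
    (T : ℕ) (hT : 1 ≤ T)
    (hfrac : ∀ t : ℕ, T ≤ t →
      δ * ((t : ℝ) - 1) ≤
        ((Finset.Icc 2 t).filter (fun τ => polTraj CE g 0 (τ - 1) ≤ xstar)).card) :
    polPayoff γ c CR CE f g 0
      ≤ ((T : ℝ) - 1) * (CR + K) +
        (CR + K) / (1 - γ * (ftilde γ c f xstar) ^ δ) := by
  have hm := fun x => ftilde_mem γ c f x hγ hc (hf01 x)
  set φ := ftilde γ c f xstar with hφ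
  obtain ⟨hφ0, hφ1⟩ : 0 ≤ φ ∧ φ ≤ 1 := hm xstar
  have hγ0 := hγ.1
  have hγ1 := hγ.2
  have hrp0 : 0 ≤ φ ^ δ := Real.rpow_nonneg hφ0 δ
  have hrp1 : φ ^ δ ≤ 1 := Real.rpow_le_one hφ0 hφ1 hδ.1.le
  have hr0 : 0 ≤ γ * φ ^ δ := mul_nonneg hγ0.le hrp0
  have hr1 : γ * φ ^ δ < 1 := by nlinarith
  have hM : 0 ≤ CR + K := by linarith
  set X := polTraj CE g 0 with hX
  set P : ℕ → ℝ := fun n => ∏ τ ∈ Finset.range n, (γ * ftilde γ c f (X (τ + 1))) with hP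
  have hP0 : ∀ n, 0 ≤ P n := fun n =>
    Finset.prod_nonneg fun τ _ => mul_nonneg hγ0.le (hm _).1
  have hPγ : ∀ n, P n ≤ γ ^ n := by
    intro n
    have : P n ≤ ∏ τ ∈ Finset.range n, γ :=
      Finset.prod_le_prod (fun τ _ => mul_nonneg hγ0.le (hm _).1)
        (fun τ _ => mul_le_of_le_one_right hγ0.le (hm _).2)
    simpa using this
  have hPr : ∀ n, T ≤ n + 1 → P n ≤ (γ * φ ^ δ) ^ n := by
    intro n hn
    have h1 := hfrac (n + 1) hn
    rw [card_shift (fun k => X k ≤ xstar) n] at h1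
    have h2 : P n ≤ ∏ τ ∈ Finset.range n, (γ * (if X (τ + 1) ≤ xstar then φ else 1)) := by
      refine Finset.prod_le_prod (fun τ _ => mul_nonneg hγ0.le (hm _).1) (fun τ _ => ?_)
      refine mul_le_mul_of_nonneg_left ?_ hγ0.le
      split_ifs with h
      · exact ftilde_mono γ c f _ _ hγ hc (hf01 _) (hf01 _) (hfmono h)
      · exact (hm _).2
    have h3 : ∏ τ ∈ Finset.range n, (γ * (if X (τ + 1) ≤ xstar then φ else 1))
        = γ ^ n * φ ^ ((Finset.range n).filter (fun τ => X (τ + 1) ≤ xstar)).card := by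
      rw [Finset.prod_mul_distrib, Finset.prod_ite]
      simp
    rw [h3] at h2
    refine h2.trans ?_
    rw [mul_pow]
    refine mul_le_mul_of_nonneg_left ?_ (pow_nonneg hγ0.le n)
    rw [← Real.rpow_mul_natCast hφ0, ← Real.rpow_natCast]
    refine Real.rpow_le_rpow_of_exponent_ge' hφ0 hφ1
      (mul_nonneg hδ.1.le (Nat.cast_nonneg n)) ?_
    push_cast at h1
    simpa using h1
  have hJ : polPayoff γ c CR CE f g 0 = ∑' n, (CR + g (X n)) * P n := by
    unfold polPayoff payoff
    simp only [stTraj_eq_polTraj, hP, hX]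
  have hs1 : Summable (fun n => (CR + g (X n)) * P n) := by
    refine Summable.of_norm_bounded
      ((summable_geometric_of_lt_one hγ0.le hγ1).mul_left (CR + K)) (fun n => ?_)
    rw [Real.norm_eq_abs, abs_mul, abs_of_nonneg (hP0 n)]
    refine mul_le_mul ?_ (hPγ n) (hP0 n) hM
    rw [abs_le]
    have := hg (X n)
    exact ⟨by linarith [this.1], by linarith [this.2]⟩
  have hs2 := hasSum_sum_of_ne_finset_zero (L := SummationFilter.unconditional ℕ) (s := Finset.range (T - 1))
    (f := fun n => if n ∈ Finset.range (T - 1) then CR + K else 0)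
    (fun n hn => if_neg hn)
  have hs3 := (hasSum_geometric_of_lt_one hr0 hr1).mul_left (CR + K)
  have hs4 := hs2.add hs3
  have e1 : ∑ n ∈ Finset.range (T - 1), (if n ∈ Finset.range (T - 1) then CR + K else 0)
      = ((T : ℝ) - 1) * (CR + K) := by
    rw [Finset.sum_congr rfl (fun n hn => if_pos hn)]
    simp [Nat.cast_sub hT]
    ring
  rw [hJ]
  rw [e1, ← div_eq_mul_inv] at hs4
  rw [← hs4.tsum_eq]
  refine hs1.tsum_le_tsum (fun n => ?_) hs4.summable
  have ha : (CR + g (X n)) * P n ≤ (CR + K) * P n :=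
    mul_le_mul_of_nonneg_right (by linarith [(hg (X n)).2]) (hP0 n)
  refine ha.trans ?_
  have hb : 0 ≤ (CR + K) * (γ * φ ^ δ) ^ n := mul_nonneg hM (pow_nonneg hr0 n)
  split_ifs with h
  · have : (CR + K) * P n ≤ CR + K :=
      mul_le_of_le_one_right hM ((hPγ n).trans (pow_le_one₀ hγ0.le hγ1.le))
    linarith
  · rw [zero_add]
    refine mul_le_mul_of_nonneg_left (hPr n ?_) hM
    rw [Finset.mem_range] at h
    omega
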